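/- arXiv:2007.13309 — 2 statements merged into one kernel-verified Lean document; each statement's English description precedes it below -/
import Mathlib

section
/- Let q ≥ 5 be an odd prime power, m ≥ 2 an even integer, and r = q+1. For every integer δ with 2 ≤ δ ≤ δ^max, the cardinality of ∪_{i=0}^{δ−2} C_{1+r·i} (cosets modulo q^{2m}−1) equals (δ−N₁−1)·m if 2 ≤ δ < i*+2+(q^m−1)/(q+1), and equals (δ−N₁−N₂−1)·m if i*+2+(q^m−1)/(q+1) ≤ δ ≤ δ^max. -/
/-- The q²-cyclotomic coset of `s` modulo `M`, viewed inside `ZMod M`. -/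
def coset (q M s : ℕ) : Set (ZMod M) :=
  {x | ∃ l : ℕ, x = (s : ZMod M) * (q : ZMod M) ^ (2 * l)}

/-- The maximum design distance `δ^max`. -/
def deltaMax (q m : ℕ) : ℕ :=
  if m = 2 ∧ 5 ≤ q then (q ^ 3 - q ^ 2 + q + 3) / (q + 1) + 1
  else (q ^ (m + 1) - q ^ 2 + q + 3) / (q + 1)

/-- `N₁ = ⌊(δ−(q+1))/q²⌋ + 1`, floor division in `ℤ`. -/
def N1 (q δ : ℕ) : ℤ :=
  ((δ : ℤ) - ((q : ℤ) + 1)).fdiv ((q : ℤ) ^ 2) + 1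

/-- `N₂` for odd `q ≥ 5`: `⌊(q+1)(δ−3)/(q^m−1) − (q+1)/2⌋` when
`i*+2+(q^m−1)/(q+1) ≤ δ ≤ δ^max` with `i* = (q^m+1)/2`, and `0` otherwise. -/
def N2odd (q m δ : ℕ) : ℤ :=
  if (q ^ m + 1) / 2 + 2 + (q ^ m - 1) / (q + 1) ≤ δ ∧ δ ≤ deltaMax q m then
    (((q : ℤ) + 1) * ((δ : ℤ) - 3)).fdiv ((q : ℤ) ^ m - 1) - ((q + 1) / 2 : ℕ)
  else 0

theorem sq_modEq_one (q : ℕ) (hq : 0 < q) : q ^ 2 ≡ 1 [MOD q + 1] := by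
  obtain ⟨k, rfl⟩ : ∃ k, q = k + 1 := ⟨q - 1, by omega⟩
  have h : (k + 1) ^ 2 = 1 + (k + 1 + 1) * k := by ring
  rw [h]
  simp [Nat.ModEq]

theorem pow_two_mul_modEq_one (q l : ℕ) (hq : 0 < q) : q ^ (2 * l) ≡ 1 [MOD q + 1] := by
  rw [pow_mul]
  simpa using (sq_modEq_one q hq).pow l

theorem cast_pow_period (q m : ℕ) (hq : 0 < q) :
    (q : ZMod (q ^ (2 * m) - 1)) ^ (2 * m) = 1 := by
  have h1 : 1 ≤ q ^ (2 * m) := Nat.one_le_pow _ _ hq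
  have h : ((q ^ (2 * m) - 1 : ℕ) : ZMod (q ^ (2 * m) - 1)) = 0 := ZMod.natCast_self _
  rw [Nat.cast_sub h1] at h
  push_cast at h
  exact sub_eq_zero.1 h

theorem cast_pow_mod (q m l : ℕ) (hq : 0 < q) :
    (q : ZMod (q ^ (2 * m) - 1)) ^ (2 * l) = (q : ZMod (q ^ (2 * m) - 1)) ^ (2 * (l % m)) := by
  have h : 2 * l = 2 * m * (l / m) + 2 * (l % m) := by
    have := Nat.div_add_mod l m
    rw [mul_assoc, ← Nat.mul_add, this]
  rw [h, pow_add, pow_mul _ (2 * m), cast_pow_period q m hq, one_pow, one_mul]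

theorem mem_coset_iff (q m s : ℕ) (hq : 0 < q) (hm : 0 < m) (x : ZMod (q ^ (2 * m) - 1)) :
    x ∈ coset q (q ^ (2 * m) - 1) s ↔
      ∃ l < m, x = (s : ZMod (q ^ (2 * m) - 1)) * (q : ZMod (q ^ (2 * m) - 1)) ^ (2 * l) := by
  constructor
  · rintro ⟨l, rfl⟩
    exact ⟨l % m, Nat.mod_lt _ hm, by rw [← cast_pow_mod q m l hq]⟩
  · rintro ⟨l, -, rfl⟩
    exact ⟨l, rfl⟩

theorem coset_eq_of_mem (q m s t l : ℕ) (hq : 0 < q) (hl : l ≤ m)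
    (h : (t : ZMod (q ^ (2 * m) - 1)) = s * (q : ZMod (q ^ (2 * m) - 1)) ^ (2 * l)) :
    coset q (q ^ (2 * m) - 1) t = coset q (q ^ (2 * m) - 1) s := by
  ext x
  constructor
  · rintro ⟨k, rfl⟩
    exact ⟨l + k, by rw [h]; ring⟩
  · rintro ⟨k, rfl⟩
    refine ⟨(m - l) + k, ?_⟩
    rw [h, mul_assoc, ← pow_add, show 2 * l + 2 * (m - l + k) = 2 * m + 2 * k by omega,
      pow_add, cast_pow_period q m hq, one_mul]

theorem eq_of_cast_eq {M x y : ℕ} (hx : x < M) (hy : y < M) (h : (x : ZMod M) = y) : x = y := by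
  rw [ZMod.natCast_eq_natCast_iff'] at h
  rwa [Nat.mod_eq_of_lt hx, Nat.mod_eq_of_lt hy] at h

theorem mul_pow_lt (q m s l : ℕ) (hq : 5 ≤ q) (hs : s < q ^ (m + 1)) (hl : 2 * l < m)
    (hme : Even m) : s * q ^ (2 * l) < q ^ (2 * m) - 1 := by
  obtain ⟨k, rfl⟩ := hme
  have h1 : q ^ (2 * l) ≤ q ^ (k + k - 2) := Nat.pow_le_pow_right (by omega) (by omega)
  have h2 : s * q ^ (2 * l) ≤ q ^ (k + k + 1) * q ^ (k + k - 2) := Nat.mul_le_mul hs.le h1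
  rw [← pow_add] at h2
  have h3 : q ^ (2 * (k + k)) = q ^ (k + k + 1 + (k + k - 2)) * q := by
    rw [← pow_succ]; congr 1; omega
  have h4 : 1 ≤ q ^ (k + k + 1 + (k + k - 2)) := Nat.one_le_pow _ _ (by omega)
  rw [h3]
  have : q ^ (k + k + 1 + (k + k - 2)) * 5 ≤ q ^ (k + k + 1 + (k + k - 2)) * q :=
    Nat.mul_le_mul_left _ hq
  omega

theorem cast_swap (q m a c : ℕ) (hq : 0 < q) :
    ((a * q ^ m + c : ℕ) : ZMod (q ^ (2 * m) - 1)) * (q : ZMod (q ^ (2 * m) - 1)) ^ m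
      = ((c * q ^ m + a : ℕ) : ZMod (q ^ (2 * m) - 1)) := by
  have h : (q : ZMod (q ^ (2 * m) - 1)) ^ m * (q : ZMod (q ^ (2 * m) - 1)) ^ m = 1 := by
    rw [← pow_add, ← cast_pow_period q m hq]
    congr 1
    ring
  push_cast
  linear_combination (a : ZMod (q ^ (2 * m) - 1)) * h

/-- How two members of `{s < q ^ (m + 1) : s ≡ 1 mod (q + 1)}` can share a coset. -/
theorem shift_cases (q m s t l : ℕ) (hq : 5 ≤ q) (hm : 2 ≤ m) (hme : Even m)
    (hs : s < q ^ (m + 1)) (ht : t < q ^ (m + 1)) (hs1 : s ≡ 1 [MOD q + 1]) (hl : l < m)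
    (h : (t : ZMod (q ^ (2 * m) - 1)) = s * (q : ZMod (q ^ (2 * m) - 1)) ^ (2 * l)) :
    (2 * l < m ∧ t = s * q ^ (2 * l)) ∨ (m < 2 * l ∧ s = t * q ^ (2 * (m - l))) ∨
      (2 * l = m ∧ ∃ a c, a < q ∧ c < q ∧ s = a * q ^ m + c ∧ t = c * q ^ m + a ∧
        (a + c = 1 ∨ a + c = q + 2)) := by
  have hq0 : 0 < q := by omega
  have hsM : s < q ^ (2 * m) - 1 := by
    simpa using mul_pow_lt q m s 0 hq hs (by omega) hme
  have htM : t < q ^ (2 * m) - 1 := by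
    simpa using mul_pow_lt q m t 0 hq ht (by omega) hme
  rcases lt_trichotomy (2 * l) m with h1 | h1 | h1
  · left
    refine ⟨h1, eq_of_cast_eq htM (mul_pow_lt q m s l hq hs h1 hme) ?_⟩
    rw [h]; push_cast; rfl
  · right; right
    refine ⟨h1, ?_⟩
    rw [h1] at h
    have hqB : q < q ^ m := by
      have : q ^ 2 ≤ q ^ m := Nat.pow_le_pow_right hq0 hm
      nlinarith
    have hM : q ^ (2 * m) = q ^ m * q ^ m := by rw [two_mul, pow_add]
    have hc : s % q ^ m < q ^ m := Nat.mod_lt _ (by omega)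
    have ha : s / q ^ m < q := by
      rw [Nat.div_lt_iff_lt_mul (by omega)]
      rw [pow_succ] at hs; linarith
    have hsd : s = s / q ^ m * q ^ m + s % q ^ m := by
      have := Nat.div_add_mod s (q ^ m); linarith
    generalize s / q ^ m = a at *
    generalize s % q ^ m = c at *
    have ht2 : t = c * q ^ m + a := by
      apply eq_of_cast_eq htM
      · rw [hM]
        have : (c + 1) * q ^ m ≤ q ^ m * q ^ m := Nat.mul_le_mul_right _ hc
        rw [Nat.add_mul] at this
        omega
      · rw [h, ← cast_swap q m a c hq0, ← hsd]
    have hcq : c < q := by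
      by_contra hcq
      have : q * q ^ m ≤ c * q ^ m := Nat.mul_le_mul_right _ (by omega)
      rw [pow_succ, mul_comm] at ht
      omega
    refine ⟨a, c, ha, hcq, hsd, ht2, ?_⟩
    have hac : a + c ≡ 1 [MOD q + 1] := by
      have hb : q ^ m ≡ 1 [MOD q + 1] := by
        rw [← h1]; exact pow_two_mul_modEq_one q l hq0
      have h2 : a * q ^ m + c ≡ a * 1 + c [MOD q + 1] := (hb.mul_left a).add_right c
      rw [← hsd, mul_one] at h2
      exact h2.symm.trans hs1
    rcases Nat.lt_or_ge (a + c) (q + 1) with h3 | h3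
    · left
      exact hac.eq_of_lt_of_lt h3 (by omega)
    · right
      have h4 : a + c - (q + 1) ≡ 1 [MOD q + 1] := by
        have : a + c - (q + 1) + (q + 1) ≡ 1 [MOD q + 1] := by
          rwa [Nat.sub_add_cancel h3]
        simpa [Nat.ModEq] using this
      have := h4.eq_of_lt_of_lt (by omega) (by omega)
      omega
  · right; left
    refine ⟨h1, eq_of_cast_eq hsM (mul_pow_lt q m t (m - l) hq ht (by omega) hme) ?_⟩
    push_cast
    rw [h, mul_assoc, ← pow_add, show 2 * l + 2 * (m - l) = 2 * m by omega,
      cast_pow_period q m hq0, mul_one]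

/-- `s` is not the least element of its coset among residues `1` modulo `q + 1`. -/
def Redundant (q m s : ℕ) : Prop :=
  q ^ 2 ∣ s ∨ ∃ a c, a < q ∧ c < a ∧ a + c = q + 2 ∧ s = a * q ^ m + c

theorem redundant_of_lt (q m s t l : ℕ) (hq : 5 ≤ q) (hm : 2 ≤ m) (hme : Even m)
    (hs : s < q ^ (m + 1)) (hts : t < s) (hs1 : s ≡ 1 [MOD q + 1]) (hl : l < m)
    (h : (t : ZMod (q ^ (2 * m) - 1)) = s * (q : ZMod (q ^ (2 * m) - 1)) ^ (2 * l)) :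
    Redundant q m s := by
  rcases shift_cases q m s t l hq hm hme hs (hts.trans hs) hs1 hl h with
    ⟨-, h2⟩ | ⟨-, h2⟩ | ⟨-, a, c, ha, hc, h2, h3, h4⟩
  · have : s * 1 ≤ s * q ^ (2 * l) := Nat.mul_le_mul_left _ (Nat.one_le_pow _ _ (by omega))
    omega
  · left
    rw [h2]
    exact Dvd.dvd.mul_left (pow_dvd_pow q (by omega)) t
  · have hca : c < a := by
      by_contra hca
      obtain ⟨d, rfl⟩ : ∃ d, c = a + d := ⟨c - a, by omega⟩
      have : d * 1 ≤ d * q ^ m := Nat.mul_le_mul_left _ (Nat.one_le_pow _ _ (by omega))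
      rw [Nat.add_mul] at h3
      omega
    rcases h4 with h4 | h4
    · left
      obtain ⟨rfl, rfl⟩ : a = 1 ∧ c = 0 := by omega
      rw [h2, one_mul, add_zero]
      exact pow_dvd_pow q hm
    · exact Or.inr ⟨a, c, ha, hca, h4, h2⟩

theorem shift_eq_zero (q m s l : ℕ) (hq : 5 ≤ q) (hqo : Odd q) (hm : 2 ≤ m) (hme : Even m)
    (hs0 : 0 < s) (hs : s < q ^ (m + 1)) (hs1 : s ≡ 1 [MOD q + 1]) (hl : l < m)
    (h : (s : ZMod (q ^ (2 * m) - 1)) = s * (q : ZMod (q ^ (2 * m) - 1)) ^ (2 * l)) :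
    l = 0 := by
  have key : ∀ k, s = s * q ^ (2 * k) → k = 0 := by
    intro k hk
    by_contra hk0
    have h1 : 1 < q ^ (2 * k) := Nat.one_lt_pow (by omega) (by omega)
    have := Nat.mul_lt_mul_of_pos_left h1 hs0
    omega
  rcases shift_cases q m s s l hq hm hme hs hs hs1 hl h with
    ⟨-, h2⟩ | ⟨h1, h2⟩ | ⟨-, a, c, ha, hc, h2, h3, h4⟩
  · exact key l h2
  · have := key _ h2
    omega
  · exfalso
    have hac : a = c := by
      have hqB : q ≤ q ^ m := by
        simpa using Nat.pow_le_pow_right (n := q) (by omega) (show 1 ≤ m by omega)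
      have e := h2.symm.trans h3
      have e2 := congrArg (· % q ^ m) e
      simp only [Nat.mul_add_mod_self_right] at e2
      rw [Nat.mod_eq_of_lt (by omega), Nat.mod_eq_of_lt (by omega)] at e2
      exact e2.symm
    obtain ⟨k, rfl⟩ := hqo
    omega

theorem ncard_coset (q m s : ℕ) (hq : 5 ≤ q) (hqo : Odd q) (hm : 2 ≤ m) (hme : Even m)
    (hs0 : 0 < s) (hs : s < q ^ (m + 1)) (hs1 : s ≡ 1 [MOD q + 1]) :
    (coset q (q ^ (2 * m) - 1) s).ncard = m := by
  have hq0 : 0 < q := by omega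
  have himg : coset q (q ^ (2 * m) - 1) s =
      (fun l => (s : ZMod (q ^ (2 * m) - 1)) * (q : ZMod (q ^ (2 * m) - 1)) ^ (2 * l)) ''
        (Finset.range m : Set ℕ) := by
    ext x
    rw [mem_coset_iff q m s hq0 (by omega)]
    simp [eq_comm]
  have inj : ∀ l k, l < m → k < m → l ≤ k →
      (s : ZMod (q ^ (2 * m) - 1)) * (q : ZMod (q ^ (2 * m) - 1)) ^ (2 * l) =
        s * (q : ZMod (q ^ (2 * m) - 1)) ^ (2 * k) → l = k := by
    intro l k hl hk hlk h
    have h2 := congrArg (· * (q : ZMod (q ^ (2 * m) - 1)) ^ (2 * (m - l))) h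
    simp only [mul_assoc, ← pow_add] at h2
    rw [show 2 * l + 2 * (m - l) = 2 * m by omega,
      show 2 * k + 2 * (m - l) = 2 * m + 2 * (k - l) by omega, pow_add,
      cast_pow_period q m hq0, one_mul, mul_one] at h2
    have := shift_eq_zero q m s (k - l) hq hqo hm hme hs0 hs hs1 (by omega) h2
    omega
  rw [himg, Set.InjOn.ncard_image, Set.ncard_coe_finset, Finset.card_range]
  intro l hl k hk h
  simp only [Finset.coe_range, Set.mem_Iio] at hl hk
  rcases le_total l k with hlk | hlk
  · exact inj l k hl hk hlk h
  · exact (inj k l hk hl hlk h.symm).symm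

theorem disjoint_coset (q m s t : ℕ) (hq : 5 ≤ q) (hm : 2 ≤ m) (hme : Even m)
    (hs : s < q ^ (m + 1)) (hts : t < s) (hs1 : s ≡ 1 [MOD q + 1]) (hR : ¬ Redundant q m s) :
    Disjoint (coset q (q ^ (2 * m) - 1) t) (coset q (q ^ (2 * m) - 1) s) := by
  have hq0 : 0 < q := by omega
  rw [Set.disjoint_left]
  intro x hx hx2
  obtain ⟨l, hl, rfl⟩ := (mem_coset_iff q m t hq0 (by omega) x).1 hx
  obtain ⟨k, hk, h⟩ := (mem_coset_iff q m s hq0 (by omega) _).1 hx2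
  apply hR
  refine redundant_of_lt q m s t ((k + (m - l)) % m) hq hm hme hs hts hs1
    (Nat.mod_lt _ (by omega)) ?_
  rw [← cast_pow_mod q m _ hq0, Nat.mul_add, pow_add, ← mul_assoc, ← h, mul_assoc, ← pow_add,
    show 2 * l + 2 * (m - l) = 2 * m by omega, cast_pow_period q m hq0, mul_one]

theorem exists_coset_eq_of_redundant (q m n : ℕ) (hq : 5 ≤ q) (hm : 2 ≤ m) (hme : Even m)
    (hR : Redundant q m (1 + (q + 1) * n)) :
    ∃ j < n, coset q (q ^ (2 * m) - 1) (1 + (q + 1) * n) =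
      coset q (q ^ (2 * m) - 1) (1 + (q + 1) * j) := by
  have hq0 : 0 < q := by omega
  have of_modEq : ∀ t, t < 1 + (q + 1) * n → t ≡ 1 [MOD q + 1] →
      ∃ j < n, t = 1 + (q + 1) * j := by
    intro t ht h1
    have h2 : t % (q + 1) = 1 := by
      rw [h1, Nat.mod_eq_of_lt (by omega)]
    have h3 := Nat.mod_add_div t (q + 1)
    rw [h2] at h3
    refine ⟨t / (q + 1), ?_, h3.symm⟩
    have : (q + 1) * (t / (q + 1)) < (q + 1) * n := by omega
    exact Nat.lt_of_mul_lt_mul_left this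
  have hs1 : 1 + (q + 1) * n ≡ 1 [MOD q + 1] := by simp [Nat.ModEq]
  rcases hR with ⟨t, ht⟩ | ⟨a, c, ha, hca, hac, hs⟩
  · have h1 : t ≡ 1 [MOD q + 1] := by
      have h2 := (sq_modEq_one q hq0).mul_right t
      rw [← ht, one_mul] at h2
      exact h2.symm.trans hs1
    have hlt : t < 1 + (q + 1) * n := by
      rw [ht]
      have : 0 < t := by
        rcases Nat.eq_zero_or_pos t with rfl | h
        · simp at ht
        · exact h
      have h2 : 1 < q ^ 2 := Nat.one_lt_pow (by omega) (by omega)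
      exact lt_mul_of_one_lt_left this h2
    obtain ⟨j, hj, rfl⟩ := of_modEq t hlt h1
    refine ⟨j, hj, coset_eq_of_mem q m _ _ 1 hq0 (by omega) ?_⟩
    rw [ht]; push_cast; ring
  · obtain ⟨k, rfl⟩ := hme
    have h1 : c * q ^ (k + k) + a ≡ 1 [MOD q + 1] := by
      have hb := pow_two_mul_modEq_one q k hq0
      rw [two_mul] at hb
      have h2 : c * q ^ (k + k) + a ≡ c * 1 + a [MOD q + 1] := (hb.mul_left c).add_right a
      refine h2.trans ?_
      rw [mul_one, add_comm c, hac, show q + 2 = 1 + (q + 1) by ring]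
      simp [Nat.ModEq]
    have hlt : c * q ^ (k + k) + a < 1 + (q + 1) * n := by
      rw [hs]
      obtain ⟨d, rfl⟩ : ∃ d, a = c + d := ⟨a - c, by omega⟩
      have hB : 1 < q ^ (k + k) := Nat.one_lt_pow (by omega) (by omega)
      have := Nat.mul_lt_mul_of_pos_left hB (show 0 < d by omega)
      rw [Nat.add_mul]
      omega
    obtain ⟨j, hj, hj2⟩ := of_modEq _ hlt h1
    refine ⟨j, hj, coset_eq_of_mem q (k + k) _ _ k hq0 (by omega) ?_⟩
    rw [hs, ← hj2, show 2 * k = k + k by ring, cast_swap q (k + k) c a hq0]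

theorem pow_eq_mul_add_one (q m : ℕ) (hq : 0 < q) (hme : Even m) :
    ∃ P, q ^ m = (q + 1) * P + 1 := by
  obtain ⟨k, rfl⟩ := hme
  have h := pow_two_mul_modEq_one q k hq
  rw [two_mul] at h
  obtain ⟨P, hP⟩ := (Nat.modEq_iff_dvd' (Nat.one_le_pow _ _ hq)).1 h.symm
  have : 1 ≤ q ^ (k + k) := Nat.one_le_pow _ _ hq
  exact ⟨P, by omega⟩

theorem sq_dvd_iff (q n : ℕ) (hq : 0 < q) :
    q ^ 2 ∣ 1 + (q + 1) * n ↔ q ^ 2 ∣ n + (q ^ 2 - q) + 1 := by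
  have hle : q ≤ q ^ 2 := by nlinarith
  have h : (q + 1) * (n + (q ^ 2 - q) + 1) = 1 + (q + 1) * n + q ^ 2 * q := by
    zify [hle]
    ring
  have hc : Nat.Coprime (q ^ 2) (q + 1) := by
    apply Nat.Coprime.pow_left
    simp
  rw [← hc.dvd_mul_left (n := n + (q ^ 2 - q) + 1), h, Nat.dvd_add_left (dvd_mul_right _ _)]

theorem exists_swap_iff (q m n P : ℕ) (hP : q ^ m = (q + 1) * P + 1)
    (hn : 1 + (q + 1) * n < q ^ (m + 1)) :
    (∃ a c, a < q ∧ c < a ∧ a + c = q + 2 ∧ 1 + (q + 1) * n = a * q ^ m + c) ↔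
      ∃ a, q + 3 ≤ 2 * a ∧ n = 1 + a * P := by
  constructor
  · rintro ⟨a, c, ha, hca, hac, hs⟩
    refine ⟨a, by omega, ?_⟩
    rw [hP] at hs
    have : (q + 1) * n = (q + 1) * (1 + a * P) := by
      nlinarith
    exact Nat.eq_of_mul_eq_mul_left (by omega) this
  · rintro ⟨a, ha, rfl⟩
    have haq : a < q := by
      by_contra h
      rw [pow_succ, hP] at hn
      have h1 : q * P ≤ a * P := Nat.mul_le_mul_right _ (by omega)
      have h2 := Nat.mul_le_mul_left (q + 1) h1
      nlinarith
    obtain ⟨c, hc⟩ : ∃ c, a + c = q + 2 := ⟨q + 2 - a, by omega⟩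
    refine ⟨a, c, haq, by omega, hc, ?_⟩
    rw [hP]
    linear_combination hc.symm

theorem not_sq_dvd_of_exists_swap (q m s : ℕ) (hm : 2 ≤ m)
    (h : ∃ a c, a < q ∧ c < a ∧ a + c = q + 2 ∧ s = a * q ^ m + c) : ¬ q ^ 2 ∣ s := by
  rintro hd
  obtain ⟨a, c, ha, hca, hac, rfl⟩ := h
  rw [Nat.dvd_add_right (Dvd.dvd.mul_left (pow_dvd_pow q hm) a)] at hd
  have := Nat.le_of_dvd (by omega) hd
  nlinarith

theorem div_sub_succ (q n P : ℕ) (hqo : Odd q) (hP : 0 < P)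
    [Decidable (∃ a, q + 3 ≤ 2 * a ∧ n = 1 + a * P)] :
    (n + 1 - 2) / P - (q + 1) / 2 =
      (n - 2) / P - (q + 1) / 2 + if ∃ a, q + 3 ≤ 2 * a ∧ n = 1 + a * P then 1 else 0 := by
  obtain ⟨t, rfl⟩ := hqo
  rcases n with _ | _ | k
  · rw [if_neg]
    · simp
    · rintro ⟨a, -, h⟩
      omega
  · rw [if_neg]
    · simp
    · rintro ⟨a, ha, h⟩
      have : 0 < a * P := Nat.mul_pos (by omega) hP
      omega
  · rw [show k + 1 + 1 + 1 - 2 = k + 1 by omega, show k + 1 + 1 - 2 = k by omega, Nat.succ_div]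
    have hdm := Nat.div_add_mod k P
    by_cases hd : P ∣ k + 1
    · rw [if_pos hd]
      have hk : (k / P + 1) * P = k + 1 := by
        have h1 : (k + 1) / P = k / P + 1 := by rw [Nat.succ_div, if_pos hd]
        rw [← h1, Nat.div_mul_cancel hd]
      split_ifs with h
      · obtain ⟨a, ha, hka⟩ := h
        have h2 : a * P = (k / P + 1) * P := by omega
        have := Nat.eq_of_mul_eq_mul_right hP h2
        omega
      · have : ¬ (2 * t + 1 + 3 ≤ 2 * (k / P + 1)) := fun h1 => h ⟨k / P + 1, h1, by omega⟩
        omega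
    · rw [if_neg hd, if_neg]
      · simp
      · rintro ⟨a, -, h⟩
        exact hd ⟨a, by rw [mul_comm]; omega⟩

theorem ncard_iUnion_coset (q m P n : ℕ) (hq : 5 ≤ q) (hqo : Odd q) (hm : 2 ≤ m) (hme : Even m)
    (hP : q ^ m = (q + 1) * P + 1) (hn : ∀ i < n, 1 + (q + 1) * i < q ^ (m + 1)) :
    (⋃ i ∈ Finset.range n, coset q (q ^ (2 * m) - 1) (1 + (q + 1) * i)).ncard +
      m * ((n + (q ^ 2 - q)) / q ^ 2 + ((n - 2) / P - (q + 1) / 2)) = m * n := by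
  classical
  have hq0 : 0 < q := by omega
  have hP0 : 0 < P := by
    rcases Nat.eq_zero_or_pos P with rfl | h
    · have : 1 < q ^ m := Nat.one_lt_pow (by omega) (by omega)
      omega
    · exact h
  induction n with
  | zero =>
    have : q ^ 2 - q < q ^ 2 := Nat.sub_lt (by positivity) hq0
    simp [Nat.div_eq_of_lt this]
  | succ n ih =>
    have ih := ih fun i hi => hn i (by omega)
    have hs := hn n (by omega)
    have hs1 : 1 + (q + 1) * n ≡ 1 [MOD q + 1] := by simp [Nat.ModEq]
    have hF : (n + 1 + (q ^ 2 - q)) / q ^ 2 =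
        (n + (q ^ 2 - q)) / q ^ 2 + if q ^ 2 ∣ 1 + (q + 1) * n then 1 else 0 := by
      rw [show n + 1 + (q ^ 2 - q) = n + (q ^ 2 - q) + 1 by omega, Nat.succ_div]
      simp only [sq_dvd_iff q n hq0]
    have hG := div_sub_succ q n P hqo hP0
    simp only [← exists_swap_iff q m n P hP hs] at hG
    have hU : (⋃ i ∈ Finset.range (n + 1), coset q (q ^ (2 * m) - 1) (1 + (q + 1) * i)) =
        (⋃ i ∈ Finset.range n, coset q (q ^ (2 * m) - 1) (1 + (q + 1) * i)) ∪
          coset q (q ^ (2 * m) - 1) (1 + (q + 1) * n) := by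
      rw [Finset.range_add_one, Finset.set_biUnion_insert, Set.union_comm]
    rw [hF, hG, hU]
    by_cases hR : Redundant q m (1 + (q + 1) * n)
    · obtain ⟨j, hj, hjn⟩ := exists_coset_eq_of_redundant q m n hq hm hme hR
      rw [Set.union_eq_left.2]
      · rcases hR with hR | hR
        · rw [if_pos hR, if_neg fun h => not_sq_dvd_of_exists_swap q m _ hm h hR]
          linarith
        · rw [if_neg (not_sq_dvd_of_exists_swap q m _ hm hR), if_pos hR]
          linarith
      · rw [hjn]
        exact Set.subset_biUnion_of_mem (u := fun i => coset q (q ^ (2 * m) - 1) (1 + (q + 1) * i))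
          (Finset.mem_coe.2 (Finset.mem_range.2 hj))
    · have hM : NeZero (q ^ (2 * m) - 1) := by
        have : 1 < q ^ (2 * m) := Nat.one_lt_pow (by omega) (by omega)
        exact ⟨by omega⟩
      rw [Set.ncard_union_eq _ (Set.toFinite _) (Set.toFinite _),
        ncard_coset q m _ hq hqo hm hme (by omega) hs hs1]
      · rw [if_neg fun h => hR (Or.inl h), if_neg fun h => hR (Or.inr h)]
        linarith
      · simp only [Set.disjoint_iUnion_left]
        intro i hi
        have := Finset.mem_range.1 hi
        exact disjoint_coset q m _ _ hq hm hme hs (by nlinarith) hs1 hR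

theorem lt_pow_of_add_two_le_deltaMax (q m n : ℕ) (hq : 5 ≤ q) (hm : 2 ≤ m)
    (hn : n + 2 ≤ deltaMax q m) : 1 + (q + 1) * n < q ^ (m + 1) := by
  have hle : q ^ 2 ≤ q ^ (m + 1) := Nat.pow_le_pow_right (by omega) (by omega)
  have h2 : 5 * q ≤ q ^ 2 := by nlinarith
  have key : ∀ k, k ≤ (q ^ (m + 1) - q ^ 2 + q + 3) / (q + 1) →
      k * (q + 1) + q ^ 2 ≤ q ^ (m + 1) + q + 3 := by
    intro k hk
    have := (Nat.mul_le_mul_right (q + 1) hk).trans (Nat.div_mul_le_self _ _)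
    omega
  unfold deltaMax at hn
  split_ifs at hn with h
  · obtain ⟨rfl, -⟩ := h
    have := key (n + 1) (by simpa using hn)
    nlinarith
  · have := key (n + 2) hn
    nlinarith

theorem N1_eq (q δ : ℕ) (hq : 0 < q) (hδ : 1 ≤ δ) :
    N1 q δ = ((δ - 1 + (q ^ 2 - q)) / q ^ 2 : ℕ) := by
  have hle : q ≤ q ^ 2 := by nlinarith
  have h0 : (q : ℤ) ^ 2 ≠ 0 := by positivity
  unfold N1
  rw [Int.fdiv_eq_ediv_of_nonneg _ (by positivity), ← Int.add_mul_ediv_right _ _ h0]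
  push_cast [hle, hδ]
  congr 1
  ring

theorem N2odd_eq (q m P δ : ℕ) (hP : q ^ m = (q + 1) * P + 1) (hqo : Odd q)
    (hP0 : 0 < P) (hδmax : δ ≤ deltaMax q m) :
    (δ < (q ^ m + 1) / 2 + 2 + (q ^ m - 1) / (q + 1) ∧ (δ - 3) / P - (q + 1) / 2 = 0) ∨
    (¬ δ < (q ^ m + 1) / 2 + 2 + (q ^ m - 1) / (q + 1) ∧
      N2odd q m δ = ((δ - 3) / P - (q + 1) / 2 : ℕ)) := by
  have h1 : (q ^ m - 1) / (q + 1) = P := by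
    rw [hP, Nat.add_sub_cancel, Nat.mul_div_cancel_left _ (by omega)]
  obtain ⟨t, ht⟩ := hqo
  have h2 : (q ^ m + 1) / 2 = (t + 1) * P + 1 := by
    rw [hP, ht, show (2 * t + 1 + 1) * P + 1 + 1 = 2 * ((t + 1) * P + 1) by ring]
    simp
  have h3 : (q + 1) / 2 = t + 1 := by omega
  have h4 : (q ^ m + 1) / 2 + 2 + (q ^ m - 1) / (q + 1) = (t + 2) * P + 3 := by
    rw [h1, h2]; ring
  unfold N2odd
  rw [h4, h3]
  by_cases h : δ < (t + 2) * P + 3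
  · left
    refine ⟨h, ?_⟩
    have h0 : 0 < (t + 2) * P := by positivity
    have : (δ - 3) / P < t + 2 := by
      rw [Nat.div_lt_iff_lt_mul hP0]
      omega
    omega
  · right
    refine ⟨h, ?_⟩
    rw [if_pos ⟨by omega, hδmax⟩]
    have h5 : t + 2 ≤ (δ - 3) / P := by
      rw [Nat.le_div_iff_mul_le hP0]
      omega
    have h6 : (q : ℤ) ^ m - 1 = ((q : ℤ) + 1) * P := by
      have : ((q ^ m : ℕ) : ℤ) = (((q + 1) * P + 1 : ℕ) : ℤ) := congrArg _ hP
      push_cast at this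
      linarith
    rw [h6, Int.fdiv_eq_ediv_of_nonneg _ (by positivity), Int.mul_ediv_mul_of_pos _ _ (by positivity),
      Nat.cast_sub (by omega)]
    have : 3 ≤ δ := by omega
    push_cast [this]
    rfl

theorem stmt11 (q m : ℕ) (hq : IsPrimePow q) (hq5 : 5 ≤ q) (hqo : Odd q)
    (hm : 2 ≤ m) (hme : Even m) (r : ℕ) (hr : r = q + 1)
    (δ : ℕ) (hδ : 2 ≤ δ) (hδmax : δ ≤ deltaMax q m) :
    ((⋃ i ∈ Finset.range (δ - 1), coset q (q ^ (2 * m) - 1) (1 + r * i)).ncard : ℤ)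
      = if δ < (q ^ m + 1) / 2 + 2 + (q ^ m - 1) / (q + 1) then
          ((δ : ℤ) - N1 q δ - 1) * m
        else ((δ : ℤ) - N1 q δ - N2odd q m δ - 1) * m := by
  subst hr
  have hq0 : 0 < q := by omega
  obtain ⟨P, hP⟩ := pow_eq_mul_add_one q m hq0 hme
  have hP0 : 0 < P := by
    rcases Nat.eq_zero_or_pos P with rfl | h
    · have : 1 < q ^ m := Nat.one_lt_pow (by omega) (by omega)
      omega
    · exact h
  have key := ncard_iUnion_coset q m P (δ - 1) hq5 hqo hm hme hP fun i hi =>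
    lt_pow_of_add_two_le_deltaMax q m i hq5 hm (by omega)
  rw [show δ - 1 - 2 = δ - 3 by omega] at key
  rw [N1_eq q δ hq0 (by omega)]
  generalize (δ - 1 + (q ^ 2 - q)) / q ^ 2 = A at *
  obtain ⟨d, rfl⟩ : ∃ d, δ = d + 1 := ⟨δ - 1, by omega⟩
  rw [Nat.add_sub_cancel] at *
  rcases N2odd_eq q m P (d + 1) hP hqo hP0 hδmax with ⟨h, h2⟩ | ⟨h, h2⟩
  · rw [if_pos h]
    rw [h2] at key
    zify at key
    push_cast
    linarith
  · rw [if_neg h, h2]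
    generalize (d + 1 - 3) / P - (q + 1) / 2 = G at *
    zify at key
    push_cast
    linarith
end

section
/- Let q ≥ 8 be an even prime power, m ≥ 2 an even integer, and r = q+1. For every integer δ with 2 ≤ δ ≤ δ^max, the cardinality of ∪_{i=0}^{δ−2} C_{1+r·i} (cosets modulo q^{2m}−1) equals (δ−N₁−1)·m if 2 ≤ δ < i*+2; equals (δ−N₁−1)·m − m/2 if i*+2 ≤ δ < i*+2+(q^m−1)/(q+1); and equals (δ−N₁−N₂−1)·m − m/2 if i*+2+(q^m−1)/(q+1) ≤ δ ≤ δ^max. -/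
/-- `i* = ((q+2)·(q^m+1)/2 − 1)/(q+1)` for even `q`. -/
def istarEven (q m : ℕ) : ℕ := ((q + 2) * (q ^ m + 1) / 2 - 1) / (q + 1)

/-- `N₂` for even `q ≥ 8`: `⌊(q+1)(δ−3)/(q^m−1) − (q+2)/2⌋` when
`i*+2+(q^m−1)/(q+1) ≤ δ ≤ δ^max`, and `0` otherwise. -/
def N2even (q m δ : ℕ) : ℤ :=
  if istarEven q m + 2 + (q ^ m - 1) / (q + 1) ≤ δ ∧ δ ≤ deltaMax q m then
    (((q : ℤ) + 1) * ((δ : ℤ) - 3)).fdiv ((q : ℤ) ^ m - 1) - ((q + 2) / 2 : ℕ)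
  else 0

section Coset

variable {q m h B : ℕ}

lemma natCast_pow_two_mul_eq_one (hq : 0 < q) (m : ℕ) :
    (q : ZMod (q ^ (2 * m) - 1)) ^ (2 * m) = 1 := by
  have h1 : q ^ (2 * m) = (q ^ (2 * m) - 1) + 1 := by
    have := Nat.pow_pos (n := 2 * m) hq
    omega
  have h2 := congrArg (Nat.cast : ℕ → ZMod (q ^ (2 * m) - 1)) h1
  simpa only [Nat.cast_pow, Nat.cast_add, ZMod.natCast_self, zero_add, Nat.cast_one] using h2

lemma natCast_pow_two_mul_mod (hq : 0 < q) (m l : ℕ) :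
    (q : ZMod (q ^ (2 * m) - 1)) ^ (2 * (l % m)) = (q : ZMod (q ^ (2 * m) - 1)) ^ (2 * l) := by
  conv_rhs => rw [← Nat.mod_add_div l m, mul_add, ← mul_assoc, pow_add, pow_mul _ (2 * m),
    natCast_pow_two_mul_eq_one hq, one_pow, mul_one]

lemma coset_eq_image (hq : 0 < q) (hm : 0 < m) (s : ℕ) :
    coset q (q ^ (2 * m) - 1) s =
      (fun l : ℕ => (s : ZMod (q ^ (2 * m) - 1)) * (q : ZMod (q ^ (2 * m) - 1)) ^ (2 * l)) ''
        (Finset.range m : Set ℕ) := by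
  ext x
  constructor
  · rintro ⟨l, rfl⟩
    exact ⟨l % m, by simpa using Nat.mod_lt l hm, by simp only [natCast_pow_two_mul_mod hq]⟩
  · rintro ⟨l, -, rfl⟩
    exact ⟨l, rfl⟩

lemma coset_finite (hq : 0 < q) (hm : 0 < m) (s : ℕ) :
    (coset q (q ^ (2 * m) - 1) s).Finite := by
  rw [coset_eq_image hq hm]
  exact (Finset.finite_toSet _).image _

lemma coset_subset_of_eq_mul_pow {M s t k : ℕ}
    (hst : (s : ZMod M) = (t : ZMod M) * (q : ZMod M) ^ (2 * k)) :
    coset q M s ⊆ coset q M t := by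
  rintro x ⟨l, rfl⟩
  exact ⟨k + l, by rw [hst, mul_assoc, ← pow_add, ← mul_add]⟩

lemma exists_eq_mul_pow_of_not_disjoint (hq : 0 < q) (hm : 0 < m) {s t : ℕ}
    (hst : ¬ Disjoint (coset q (q ^ (2 * m) - 1) t) (coset q (q ^ (2 * m) - 1) s)) :
    ∃ k < m, (s : ZMod (q ^ (2 * m) - 1)) =
      (t : ZMod (q ^ (2 * m) - 1)) * (q : ZMod (q ^ (2 * m) - 1)) ^ (2 * k) := by
  rw [Set.not_disjoint_iff] at hst
  obtain ⟨x, ⟨l, hl⟩, ⟨j, hj⟩⟩ := hst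
  refine ⟨(l + (m * j - j)) % m, Nat.mod_lt _ hm, ?_⟩
  rw [natCast_pow_two_mul_mod hq, mul_add, pow_add, ← mul_assoc, ← hl, hj, mul_assoc, ← pow_add]
  have : 2 * j + 2 * (m * j - j) = 2 * m * j := by
    have : j ≤ m * j := Nat.le_mul_of_pos_left _ hm
    rw [mul_assoc]
    omega
  rw [this, pow_mul _ (2 * m), natCast_pow_two_mul_eq_one hq, one_pow, mul_one]

lemma eq_mul_pow_sub (hq : 0 < q) {s t k : ℕ} (hk : k ≤ m)
    (hst : (s : ZMod (q ^ (2 * m) - 1)) =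
      (t : ZMod (q ^ (2 * m) - 1)) * (q : ZMod (q ^ (2 * m) - 1)) ^ (2 * k)) :
    (t : ZMod (q ^ (2 * m) - 1)) =
      (s : ZMod (q ^ (2 * m) - 1)) * (q : ZMod (q ^ (2 * m) - 1)) ^ (2 * (m - k)) := by
  rw [hst, mul_assoc, ← pow_add, ← mul_add, Nat.add_sub_cancel' hk,
    natCast_pow_two_mul_eq_one hq, mul_one]

lemma injOn_coset_of_period (hq : 0 < q) {s n : ℕ} (hn : n ≤ m)
    (hs : ∀ k, 0 < k → k < n →
      (s : ZMod (q ^ (2 * m) - 1)) ≠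
        (s : ZMod (q ^ (2 * m) - 1)) * (q : ZMod (q ^ (2 * m) - 1)) ^ (2 * k)) :
    Set.InjOn (fun l : ℕ => (s : ZMod (q ^ (2 * m) - 1)) * (q : ZMod (q ^ (2 * m) - 1)) ^ (2 * l))
      (Finset.range n : Set ℕ) := by
  have key : ∀ j l, j < l → l < n →
      (s : ZMod (q ^ (2 * m) - 1)) * (q : ZMod (q ^ (2 * m) - 1)) ^ (2 * j) ≠
        (s : ZMod (q ^ (2 * m) - 1)) * (q : ZMod (q ^ (2 * m) - 1)) ^ (2 * l) := by
    intro j l hjl hl he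
    refine hs (l - j) (by omega) (by omega) ?_
    have := congrArg (fun z => z * (q : ZMod (q ^ (2 * m) - 1)) ^ (2 * (m - j))) he
    simp only [mul_assoc, ← pow_add] at this
    rw [show 2 * j + 2 * (m - j) = 2 * m by omega,
      show 2 * l + 2 * (m - j) = 2 * (l - j) + 2 * m by omega, pow_add,
      natCast_pow_two_mul_eq_one hq, mul_one, mul_one] at this
    exact this
  intro j hj l hl he
  simp only [Finset.coe_range, Set.mem_Iio] at hj hl
  rcases lt_trichotomy j l with hjl | hjl | hjl
  · exact (key j l hjl hl he).elim
  · exact hjl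
  · exact (key l j hjl hj he.symm).elim

lemma ncard_coset_of_period (hq : 0 < q) (hm : 0 < m) {s : ℕ}
    (hs : ∀ k, 0 < k → k < m →
      (s : ZMod (q ^ (2 * m) - 1)) ≠
        (s : ZMod (q ^ (2 * m) - 1)) * (q : ZMod (q ^ (2 * m) - 1)) ^ (2 * k)) :
    (coset q (q ^ (2 * m) - 1) s).ncard = m := by
  rw [coset_eq_image hq hm, (injOn_coset_of_period hq le_rfl hs).ncard_image, Set.ncard_coe_finset,
    Finset.card_range]

lemma ncard_coset_of_half_period (hq : 0 < q) (hh : 0 < h) {s : ℕ}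
    (hs : ∀ k, 0 < k → k < h →
      (s : ZMod (q ^ (2 * (2 * h)) - 1)) ≠
        (s : ZMod (q ^ (2 * (2 * h)) - 1)) * (q : ZMod (q ^ (2 * (2 * h)) - 1)) ^ (2 * k))
    (hsh : (s : ZMod (q ^ (2 * (2 * h)) - 1)) =
        (s : ZMod (q ^ (2 * (2 * h)) - 1)) * (q : ZMod (q ^ (2 * (2 * h)) - 1)) ^ (2 * h)) :
    (coset q (q ^ (2 * (2 * h)) - 1) s).ncard = h := by
  have : coset q (q ^ (2 * (2 * h)) - 1) s =
      (fun l : ℕ => (s : ZMod (q ^ (2 * (2 * h)) - 1)) *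
        (q : ZMod (q ^ (2 * (2 * h)) - 1)) ^ (2 * l)) '' (Finset.range h : Set ℕ) := by
    rw [coset_eq_image hq (by omega)]
    apply subset_antisymm
    · rintro _ ⟨l, hl, rfl⟩
      simp only [Finset.coe_range, Set.mem_Iio] at hl
      by_cases hlh : l < h
      · exact ⟨l, by simpa using hlh, rfl⟩
      · refine ⟨l - h, by simp; omega, ?_⟩
        simp only
        conv_lhs => rw [hsh, mul_assoc, ← pow_add]
        congr 2
        omega
    · apply Set.image_mono
      intro l
      simp only [Finset.coe_range, Set.mem_Iio]
      omega
  rw [this, (injOn_coset_of_period hq (by omega) hs).ncard_image, Set.ncard_coe_finset,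
    Finset.card_range]

/-- Two naturals below `q ^ (2 * h + 1)` that differ by a short shift differ by it over `ℕ`. -/
lemma eq_mul_pow_of_lt (hq : 2 ≤ q) {x y k : ℕ} (hx : x < q ^ (2 * h + 1))
    (hy : y < q ^ (2 * h + 1)) (hk : k < h)
    (hxy : (x : ZMod (q ^ (2 * (2 * h)) - 1)) =
      (y : ZMod (q ^ (2 * (2 * h)) - 1)) * (q : ZMod (q ^ (2 * (2 * h)) - 1)) ^ (2 * k)) :
    x = y * q ^ (2 * k) := by
  have hbig : ∀ n, n + 1 ≤ 2 * (2 * h) → q ^ n ≤ q ^ (2 * (2 * h)) - 1 := by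
    intro n hn
    have := Nat.pow_lt_pow_right (show 1 < q by omega) (show n < 2 * (2 * h) by omega)
    omega
  have h1 : y * q ^ (2 * k) < q ^ (2 * (2 * h)) - 1 := by
    calc y * q ^ (2 * k) < q ^ (2 * h + 1) * q ^ (2 * k) :=
          Nat.mul_lt_mul_of_pos_right hy (Nat.pow_pos (by omega))
      _ = q ^ (2 * h + 1 + 2 * k) := (pow_add _ _ _).symm
      _ ≤ _ := hbig _ (by omega)
  have h2 : x < q ^ (2 * (2 * h)) - 1 := hx.trans_le (hbig _ (by omega))
  have h3 : ((x : ℕ) : ZMod (q ^ (2 * (2 * h)) - 1)) = ((y * q ^ (2 * k) : ℕ) : ZMod _) := by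
    rw [hxy]
    push_cast
    rfl
  rw [ZMod.natCast_eq_natCast_iff] at h3
  exact h3.eq_of_lt_of_lt h2 h1

lemma natCast_mul_half_shift (hq : 0 < q) (a b : ℕ) :
    ((a * q ^ (2 * h) + b : ℕ) : ZMod (q ^ (2 * (2 * h)) - 1)) * (q : ZMod _) ^ (2 * h) =
      ((b * q ^ (2 * h) + a : ℕ) : ZMod (q ^ (2 * (2 * h)) - 1)) := by
  have hone : (q : ZMod (q ^ (2 * (2 * h)) - 1)) ^ (2 * h) * (q : ZMod _) ^ (2 * h) = 1 := by
    rw [← pow_add, ← natCast_pow_two_mul_eq_one hq (2 * h)]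
    congr 1
    omega
  push_cast
  linear_combination (a : ZMod (q ^ (2 * (2 * h)) - 1)) * hone

/-- A half-turn between naturals below `q ^ (2 * h + 1)` swaps two base-`q ^ (2 * h)` digits. -/
lemma exists_digits_of_half_shift (hq : 2 ≤ q) (hh : 0 < h) {x y : ℕ}
    (hx : x < q ^ (2 * h + 1)) (hy : y < q ^ (2 * h + 1))
    (hxy : (x : ZMod (q ^ (2 * (2 * h)) - 1)) =
      (y : ZMod (q ^ (2 * (2 * h)) - 1)) * (q : ZMod (q ^ (2 * (2 * h)) - 1)) ^ (2 * h)) :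
    ∃ a b, a < q ∧ b < q ∧ x = a * q ^ (2 * h) + b ∧ y = b * q ^ (2 * h) + a := by
  have hP : q * q ≤ q ^ (2 * h) := by
    calc q * q = q ^ 2 := by ring
      _ ≤ _ := Nat.pow_le_pow_right (by omega) (by omega)
  have hM : q ^ (2 * (2 * h)) = q ^ (2 * h) * q ^ (2 * h) := by rw [← pow_add]; congr 1; omega
  rw [pow_succ] at hx hy
  have hyd : y = (y / q ^ (2 * h)) * q ^ (2 * h) + y % q ^ (2 * h) := by
    rw [mul_comm]; exact (Nat.div_add_mod _ _).symm
  have hb : y / q ^ (2 * h) < q := Nat.div_lt_of_lt_mul hy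
  have ha : y % q ^ (2 * h) < q ^ (2 * h) := Nat.mod_lt _ (by nlinarith)
  generalize y / q ^ (2 * h) = b at *
  generalize y % q ^ (2 * h) = a at *
  subst hyd
  rw [natCast_mul_half_shift (by omega), ZMod.natCast_eq_natCast_iff, hM] at hxy
  generalize q ^ (2 * h) = P at *
  have hxM : x < P * P - 1 := by
    have : P * q + 2 ≤ P * P := by nlinarith
    omega
  have hyM : a * P + b < P * P - 1 := by
    have h1 : a * P + P ≤ P * P := by nlinarith
    have h2 : q + 2 ≤ P := by nlinarith
    omega
  have hx' := hxy.eq_of_lt_of_lt hxM hyM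
  refine ⟨a, b, ?_, hb, hx', rfl⟩
  by_contra hc
  push Not at hc
  have : q * P ≤ a * P := Nat.mul_le_mul_right _ hc
  nlinarith

/-- Coincidences `x = y * q ^ (2 * k)` with `y ≤ x` and `x` not divisible by `q ^ 2`. -/
lemma shift_cases_s12 (hq : 2 ≤ q) (hh : 0 < h) {x y k : ℕ}
    (hx : x < q ^ (2 * h + 1)) (hyx : y ≤ x) (hxd : ¬ q ^ 2 ∣ x) (hk : k < 2 * h)
    (hxy : (x : ZMod (q ^ (2 * (2 * h)) - 1)) =
      (y : ZMod (q ^ (2 * (2 * h)) - 1)) * (q : ZMod (q ^ (2 * (2 * h)) - 1)) ^ (2 * k)) :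
    (k = 0 ∧ x = y) ∨
      (k = h ∧ ∃ a b, a < q ∧ b < q ∧ x = a * q ^ (2 * h) + b ∧ y = b * q ^ (2 * h) + a) := by
  have hy := hyx.trans_lt hx
  rcases lt_trichotomy k h with hkh | hkh | hkh
  · have := eq_mul_pow_of_lt hq hx hy hkh hxy
    rcases Nat.eq_zero_or_pos k with rfl | hk0
    · left
      simpa using this
    · exact (hxd (this ▸ (pow_dvd_pow q (by omega)).mul_left _)).elim
  · subst hkh
    exact Or.inr ⟨rfl, exists_digits_of_half_shift hq hh hx hy hxy⟩
  · have := eq_mul_pow_of_lt hq hy hx (by omega) (eq_mul_pow_sub (by omega) hk.le hxy)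
    have hx0 : 0 < x := Nat.pos_of_ne_zero (by rintro rfl; simp at hxd)
    have h1 : 1 < q ^ (2 * (2 * h - k)) := Nat.one_lt_pow (by omega) (by omega)
    nlinarith

/-- The coincidences of `shift_cases` inside the residue class `1` modulo `q + 1`. -/
lemma progression_shift_cases {p : ℕ} (hp : q = 2 * p) (hq : 2 ≤ q) (hh : 0 < h)
    (hB : q ^ (2 * h) = (q + 1) * B + 1) {i j k : ℕ}
    (hi : 1 + (q + 1) * i < q ^ (2 * h + 1)) (hji : j ≤ i) (hid : ¬ q ^ 2 ∣ 1 + (q + 1) * i)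
    (hk : k < 2 * h)
    (hij : ((1 + (q + 1) * i : ℕ) : ZMod (q ^ (2 * (2 * h)) - 1)) =
      ((1 + (q + 1) * j : ℕ) : ZMod (q ^ (2 * (2 * h)) - 1)) *
        (q : ZMod (q ^ (2 * (2 * h)) - 1)) ^ (2 * k)) :
    (k = 0 ∧ i = j) ∨ (k = h ∧ ∃ a, i = a * B + 1 ∧ p + 1 ≤ a ∧ (a = p + 1 ↔ i = j)) := by
  have hP : 2 ≤ q ^ (2 * h) := by
    have := Nat.one_lt_pow (show 2 * h ≠ 0 by omega) (show 1 < q by omega)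
    omega
  have hPd : q ^ 2 ∣ q ^ (2 * h) := pow_dvd_pow q (by omega)
  rcases shift_cases_s12 hq hh hi (by gcongr) hid hk hij with ⟨h0, h1⟩ | ⟨h0, a, b, ha, hb, h1, h2⟩
  · left
    refine ⟨h0, ?_⟩
    have : (q + 1) * i = (q + 1) * j := by omega
    exact Nat.eq_of_mul_eq_mul_left (by omega) this
  · right
    refine ⟨h0, a, ?_⟩
    have hji' : (q + 1) * j ≤ (q + 1) * i := Nat.mul_le_mul_left _ hji
    have hba : b ≤ a := by
      by_contra hc
      push Not at hc
      nlinarith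
    have hmod : (a + b) % (q + 1) = 1 % (q + 1) := by
      have h3 : (q + 1) * i + 1 = (q + 1) * (a * B) + (a + b) := by
        rw [hB] at h1
        linarith
      have := congrArg (· % (q + 1)) h3
      simp only [Nat.mul_add_mod] at this
      exact this.symm
    have hsum : a + b = q + 2 := by
      rw [Nat.mod_eq_of_lt (show 1 < q + 1 by omega)] at hmod
      have h3 := Nat.div_add_mod (a + b) (q + 1)
      rw [hmod] at h3
      have h4 : (a + b) / (q + 1) < 2 := Nat.div_lt_of_lt_mul (by omega)
      interval_cases (a + b) / (q + 1)
      · have : a = 1 ∧ b = 0 := by omega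
        rw [this.1, this.2] at h1
        rw [h1] at hid
        simp only [one_mul, add_zero] at hid
        exact (hid hPd).elim
      · omega
    have hiB : i = a * B + 1 := by
      apply Nat.eq_of_mul_eq_mul_left (show 0 < q + 1 by omega)
      rw [hB] at h1
      linarith
    refine ⟨hiB, by omega, ?_, ?_⟩
    · intro hap
      have : b = a := by omega
      subst this
      apply Nat.eq_of_mul_eq_mul_left (show 0 < q + 1 by omega)
      omega
    · rintro rfl
      rcases hba.lt_or_eq with hlt | heq
      · nlinarith
      · omega

lemma sq_dvd_progression_iff (q i : ℕ) :
    q ^ 2 ∣ 1 + (q + 1) * i ↔ (q : ℤ) ^ 2 ∣ (i : ℤ) + 1 - q := by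
  rw [← Int.natCast_dvd_natCast]
  push_cast
  constructor
  · rintro ⟨k, hk⟩
    exact ⟨i - (q - 1) * k, by linear_combination (1 - (q : ℤ)) * hk⟩
  · rintro ⟨k, hk⟩
    exact ⟨1 + (q + 1) * k, by linear_combination ((q : ℤ) + 1) * hk⟩

lemma exists_coset_subset_of_sq_dvd (hq : 2 ≤ q) {i : ℕ} (hd : q ^ 2 ∣ 1 + (q + 1) * i) (M : ℕ) :
    ∃ j < i, coset q M (1 + (q + 1) * i) ⊆ coset q M (1 + (q + 1) * j) := by
  obtain ⟨t, ht⟩ := hd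
  obtain ⟨u, rfl⟩ : ∃ u, q = u + 1 := ⟨q - 1, by omega⟩
  have ht0 : 0 < t := Nat.pos_of_ne_zero (by rintro rfl; simp at ht)
  have hle : u * t ≤ i := by
    have : (u + 1 + 1) * (u * t) ≤ (u + 1 + 1) * i := by nlinarith
    exact Nat.le_of_mul_le_mul_left this (by omega)
  have hpos : 0 < u * t := Nat.mul_pos (by omega) ht0
  refine ⟨i - u * t, by omega, coset_subset_of_eq_mul_pow (k := 1) ?_⟩
  have hj : 1 + (u + 1 + 1) * (i - u * t) = t := by
    zify [hle] at ht ⊢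
    linear_combination ht
  rw [hj, ht]
  push_cast
  ring

lemma progression_mul_add_one (hB : q ^ (2 * h) = (q + 1) * B + 1) {a : ℕ} (ha : a ≤ q + 2) :
    1 + (q + 1) * (a * B + 1) = a * q ^ (2 * h) + (q + 2 - a) := by
  rw [hB]
  zify [ha]
  ring

lemma lt_of_progression_lt (hB : q ^ (2 * h) = (q + 1) * B + 1) {a : ℕ}
    (hi : 1 + (q + 1) * (a * B + 1) < q ^ (2 * h + 1)) : a < q := by
  by_contra hc
  push Not at hc
  have := Nat.mul_le_mul_right B hc
  have := Nat.mul_le_mul_left (q + 1) this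
  rw [pow_succ, hB] at hi
  nlinarith

lemma not_sq_dvd_progression_mul_add_one (hq : 2 ≤ q) (hh : 0 < h)
    (hB : q ^ (2 * h) = (q + 1) * B + 1) {a : ℕ} (ha : a < q) (ha2 : 2 ≤ a) :
    ¬ q ^ 2 ∣ 1 + (q + 1) * (a * B + 1) := by
  rw [progression_mul_add_one hB (by omega),
    Nat.dvd_add_right ((pow_dvd_pow q (by omega)).mul_left _)]
  apply Nat.not_dvd_of_pos_of_lt (by omega)
  nlinarith [show q + 2 - a ≤ q by omega]

lemma exists_coset_subset_of_mul_add_one {p : ℕ} (hp : q = 2 * p) (hq : 2 ≤ q)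
    (hB0 : 0 < B) (hB : q ^ (2 * h) = (q + 1) * B + 1) {a : ℕ} (ha : a < q) (hpa : p + 1 < a) :
    ∃ j < a * B + 1, coset q (q ^ (2 * (2 * h)) - 1) (1 + (q + 1) * (a * B + 1)) ⊆
      coset q (q ^ (2 * (2 * h)) - 1) (1 + (q + 1) * j) := by
  refine ⟨(q + 2 - a) * B + 1, ?_, coset_subset_of_eq_mul_pow (k := h) ?_⟩
  · gcongr
    omega
  · rw [progression_mul_add_one hB (by omega), progression_mul_add_one hB (by omega),
      natCast_mul_half_shift (by omega)]
    congr 3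
    omega

/-- The union of the first `n` cosets along the progression `1, 1 + (q + 1), …`. -/
def cosetUnion (q m n : ℕ) : Set (ZMod (q ^ (2 * m) - 1)) :=
  ⋃ i ∈ Finset.range n, coset q (q ^ (2 * m) - 1) (1 + (q + 1) * i)

lemma cosetUnion_succ (q m n : ℕ) : cosetUnion q m (n + 1) =
    coset q (q ^ (2 * m) - 1) (1 + (q + 1) * n) ∪ cosetUnion q m n := by
  simp only [cosetUnion, Finset.range_add_one, Finset.set_biUnion_insert]

lemma cosetUnion_finite (hq : 0 < q) (hm : 0 < m) (n : ℕ) : (cosetUnion q m n).Finite :=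
  (Finset.range n).finite_toSet.biUnion fun _ _ => coset_finite hq hm _

lemma cosetUnion_succ_of_subset {n : ℕ}
    (hn : ∃ j < n, coset q (q ^ (2 * m) - 1) (1 + (q + 1) * n) ⊆
      coset q (q ^ (2 * m) - 1) (1 + (q + 1) * j)) :
    cosetUnion q m (n + 1) = cosetUnion q m n := by
  obtain ⟨j, hj, hs⟩ := hn
  rw [cosetUnion_succ, Set.union_eq_right]
  exact hs.trans (Set.subset_biUnion_of_mem (u := fun i => coset q (q ^ (2 * m) - 1)
    (1 + (q + 1) * i)) (by simpa using hj))

lemma ncard_cosetUnion_succ_of_disjoint (hq : 0 < q) (hm : 0 < m) {n : ℕ}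
    (hn : ∀ j < n, ∀ k < m, ((1 + (q + 1) * n : ℕ) : ZMod (q ^ (2 * m) - 1)) ≠
      ((1 + (q + 1) * j : ℕ) : ZMod (q ^ (2 * m) - 1)) * (q : ZMod (q ^ (2 * m) - 1)) ^ (2 * k)) :
    (cosetUnion q m (n + 1)).ncard =
      (coset q (q ^ (2 * m) - 1) (1 + (q + 1) * n)).ncard + (cosetUnion q m n).ncard := by
  rw [cosetUnion_succ, Set.ncard_union_eq ?_ (coset_finite hq hm _) (cosetUnion_finite hq hm _)]
  simp only [cosetUnion, Set.disjoint_iUnion_right, Finset.mem_range]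
  intro j hj
  by_contra hc
  obtain ⟨k, hk, he⟩ := exists_eq_mul_pow_of_not_disjoint hq hm (fun hd => hc hd.symm)
  exact hn j hj k hk he

lemma ncard_cosetUnion_succ_of_regular {p n : ℕ} (hp : q = 2 * p) (hq : 2 ≤ q) (hh : 0 < h)
    (hB : q ^ (2 * h) = (q + 1) * B + 1) (hn : 1 + (q + 1) * n < q ^ (2 * h + 1))
    (hd : ¬ q ^ 2 ∣ 1 + (q + 1) * n) (hr : ∀ a, p + 1 ≤ a → n ≠ a * B + 1) :
    (cosetUnion q (2 * h) (n + 1)).ncard = 2 * h + (cosetUnion q (2 * h) n).ncard := by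
  rw [ncard_cosetUnion_succ_of_disjoint (by omega) (by omega),
    ncard_coset_of_period (by omega) (by omega)]
  · intro k hk0 hk he
    rcases progression_shift_cases hp hq hh hB hn le_rfl hd hk he with h1 | ⟨-, a, ha, hpa, -⟩
    · omega
    · exact hr a hpa ha
  · intro j hj k hk he
    rcases progression_shift_cases hp hq hh hB hn hj.le hd hk he with h1 | ⟨-, a, ha, hpa, -⟩
    · omega
    · exact hr a hpa ha

lemma ncard_cosetUnion_succ_of_middle {p n : ℕ} (hp : q = 2 * p) (hq : 3 ≤ q) (hh : 0 < h)
    (hB0 : 0 < B) (hB : q ^ (2 * h) = (q + 1) * B + 1) (hn : 1 + (q + 1) * n < q ^ (2 * h + 1))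
    (hnB : n = (p + 1) * B + 1) :
    (cosetUnion q (2 * h) (n + 1)).ncard = h + (cosetUnion q (2 * h) n).ncard := by
  have hd : ¬ q ^ 2 ∣ 1 + (q + 1) * n := by
    rw [hnB]
    exact not_sq_dvd_progression_mul_add_one (by omega) hh hB (by omega) (by omega)
  have huniq : ∀ a, n = a * B + 1 → a = p + 1 := by
    intro a ha
    apply Nat.eq_of_mul_eq_mul_right hB0
    omega
  rw [ncard_cosetUnion_succ_of_disjoint (by omega) (by omega),
    ncard_coset_of_half_period (by omega) hh]
  · intro k hk0 hk he
    rcases progression_shift_cases hp (by omega) hh hB hn le_rfl hd (by omega) he with h1 | h1 <;>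
      omega
  · rw [hnB, progression_mul_add_one hB (by omega), natCast_mul_half_shift (by omega)]
    congr 3 <;> omega
  · intro j hj k hk he
    rcases progression_shift_cases hp (by omega) hh hB hn hj.le hd hk he with
      h1 | ⟨-, a, ha, -, hiff⟩
    · omega
    · have := hiff.1 (huniq a ha)
      omega

end Coset

lemma int_ediv_eq_sub_one_ediv_add (z b : ℤ) (hb : 0 < b) :
    z / b = (z - 1) / b + if b ∣ z then 1 else 0 := by
  split_ifs with hd
  · obtain ⟨k, rfl⟩ := hd
    have : (b * k - 1) / b = k - 1 := by
      rw [Int.ediv_eq_iff_of_pos hb]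
      constructor <;> linarith
    rw [this, Int.mul_ediv_cancel_left _ hb.ne']
    ring
  · have h1 : (z - 1) / b = z / b := by
      rw [Int.ediv_eq_iff_of_pos hb]
      have h2 := Int.emod_nonneg z hb.ne'
      have h3 := Int.emod_lt_of_pos z hb
      have h4 := Int.mul_ediv_add_emod z b
      have h5 : z % b ≠ 0 := fun h => hd (Int.dvd_of_emod_eq_zero h)
      have h6 : 1 ≤ z % b := by omega
      constructor <;> nlinarith
    omega

lemma N1_succ {q : ℕ} (hq : 0 < q) (n : ℕ) :
    N1 q (n + 1 + 1) = N1 q (n + 1) + if q ^ 2 ∣ 1 + (q + 1) * n then 1 else 0 := by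
  have hq2 : (0 : ℤ) < (q : ℤ) ^ 2 := by positivity
  simp only [N1, Int.fdiv_eq_ediv_of_nonneg _ hq2.le, sq_dvd_progression_iff]
  push_cast
  rw [show (n : ℤ) + 1 + 1 - (q + 1) = n + 1 - q by ring,
    int_ediv_eq_sub_one_ediv_add _ _ hq2, show (n : ℤ) + 1 - (q + 1) = n + 1 - q - 1 by ring]
  ring

/-- The number of elements lost to half-turn coincidences among the first `n` cosets. -/
def halfTurnLoss (p h B n : ℕ) : ℤ :=
  if ((n : ℤ) - 2) / B < p + 1 then 0 else h + 2 * h * (((n : ℤ) - 2) / B - (p + 1))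

lemma halfTurnLoss_succ_of_forall_ne {p h B n : ℕ} (hB0 : 0 < B)
    (hr : ∀ a, p + 1 ≤ a → n ≠ a * B + 1) :
    halfTurnLoss p h B (n + 1) = halfTurnLoss p h B n := by
  have hB0' : (0 : ℤ) < B := by exact_mod_cast hB0
  have hstep := int_ediv_eq_sub_one_ediv_add ((n : ℤ) - 1) B hB0'
  simp only [halfTurnLoss]
  push_cast
  rw [show (n : ℤ) + 1 - 2 = n - 1 by ring]
  rw [show (n : ℤ) - 1 - 1 = n - 2 by ring] at hstep
  split_ifs at hstep with hd
  · obtain ⟨k, hk⟩ := hd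
    have hk' : ((n : ℤ) - 1) / B = k := by rw [hk, Int.mul_ediv_cancel_left _ hB0'.ne']
    have hkp : k < p + 1 := by
      by_contra hc
      push Not at hc
      refine hr k.toNat (by omega) ?_
      zify
      rw [Int.toNat_of_nonneg (by omega)]
      linarith
    rw [if_pos (by omega), if_pos (by omega)]
  · rw [add_zero] at hstep
    rw [hstep]

lemma halfTurnLoss_mul_add_one {p h B a : ℕ} (hB0 : 0 < B) :
    halfTurnLoss p h B (a * B + 1 + 1) =
      if a < p + 1 then 0 else h + 2 * h * ((a : ℤ) - (p + 1)) := by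
  have hB0' : (0 : ℤ) < B := by exact_mod_cast hB0
  have hdiv : (((a * B + 1 + 1 : ℕ) : ℤ) - 2) / B = a := by
    push_cast
    rw [show (a : ℤ) * B + 1 + 1 - 2 = a * B by ring, Int.mul_ediv_cancel _ hB0'.ne']
  simp only [halfTurnLoss, hdiv]
  norm_cast

lemma halfTurnLoss_mul_add_one_pred {p h B a : ℕ} (hB0 : 0 < B) :
    halfTurnLoss p h B (a * B + 1) =
      if a < p + 2 then 0 else h + 2 * h * ((a : ℤ) - 1 - (p + 1)) := by
  have hB0' : (0 : ℤ) < B := by exact_mod_cast hB0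
  have hdiv : (((a * B + 1 : ℕ) : ℤ) - 2) / B = a - 1 := by
    have := int_ediv_eq_sub_one_ediv_add ((a : ℤ) * B) B hB0'
    rw [if_pos (dvd_mul_left _ _), Int.mul_ediv_cancel _ hB0'.ne'] at this
    push_cast
    rw [show (a : ℤ) * B + 1 - 2 = a * B - 1 by ring]
    omega
  simp only [halfTurnLoss, hdiv]
  congr 1
  simp only [eq_iff_iff]
  omega

theorem ncard_cosetUnion {q h B p : ℕ} (hp : q = 2 * p) (hq : 4 ≤ q) (hh : 0 < h) (hB0 : 0 < B)
    (hB : q ^ (2 * h) = (q + 1) * B + 1) (n : ℕ)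
    (hn : ∀ i < n, 1 + (q + 1) * i < q ^ (2 * h + 1)) :
    ((cosetUnion q (2 * h) n).ncard : ℤ) =
      ((n : ℤ) - N1 q (n + 1)) * (2 * h) - halfTurnLoss p h B n := by
  induction n with
  | zero =>
    have hB0' : (0 : ℤ) < B := by exact_mod_cast hB0
    have h1 : N1 q (0 + 1) = 0 := by
      have hq2 : (0 : ℤ) < (q : ℤ) ^ 2 := by positivity
      have : (-(q : ℤ)) / (q : ℤ) ^ 2 = -1 := by
        rw [Int.ediv_eq_iff_of_pos hq2]
        constructor <;> nlinarith
      simp [N1, Int.fdiv_eq_ediv_of_nonneg _ hq2.le, this]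
    have h2 : halfTurnLoss p h B 0 = 0 := by
      have : (((0 : ℕ) : ℤ) - 2) / B < 0 := Int.ediv_neg_of_neg_of_pos (by norm_num) hB0'
      rw [halfTurnLoss, if_pos (by omega)]
    simp [h1, h2, cosetUnion]
  | succ n ih =>
    specialize ih fun i hi => hn i (by omega)
    have hnn := hn n (by omega)
    rw [N1_succ (by omega)]
    by_cases hr : ∀ a, p + 1 ≤ a → n ≠ a * B + 1
    · rw [halfTurnLoss_succ_of_forall_ne hB0 hr]
      split_ifs with hd
      · rw [cosetUnion_succ_of_subset (exists_coset_subset_of_sq_dvd (by omega) hd _), ih]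
        push_cast
        ring
      · rw [ncard_cosetUnion_succ_of_regular hp (by omega) hh hB hnn hd hr]
        push_cast
        rw [ih]
        ring
    · push Not at hr
      obtain ⟨a, hpa, rfl⟩ := hr
      have haq : a < q := lt_of_progression_lt hB hnn
      rw [if_neg (not_sq_dvd_progression_mul_add_one (by omega) hh hB haq (by omega)),
        halfTurnLoss_mul_add_one hB0, if_neg (by omega)]
      rw [halfTurnLoss_mul_add_one_pred hB0] at ih
      rcases hpa.eq_or_lt with rfl | hlt
      · rw [ncard_cosetUnion_succ_of_middle hp (by omega) hh hB0 hB hnn rfl]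
        rw [if_pos (by omega)] at ih
        push_cast at ih ⊢
        rw [ih]
        ring
      · rw [cosetUnion_succ_of_subset
          (exists_coset_subset_of_mul_add_one hp (by omega) hB0 hB haq hlt), ih, if_neg (by omega)]
        push_cast
        ring

lemma istarEven_eq {q m B p : ℕ} (hp : q = 2 * p) (hB : q ^ m = (q + 1) * B + 1) :
    istarEven q m = (p + 1) * B + 1 := by
  have h1 : (q + 2) * (q ^ m + 1) / 2 - 1 = (q + 1) * ((p + 1) * B + 1) := by
    have : (q + 2) * (q ^ m + 1) = 2 * ((q + 1) * ((p + 1) * B + 1) + 1) := by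
      rw [hB, hp]
      ring
    rw [this, Nat.mul_div_cancel_left _ (by norm_num), Nat.add_sub_cancel]
  rw [istarEven, h1, Nat.mul_div_cancel_left _ (by omega)]

lemma progression_lt_of_lt_deltaMax {q m i : ℕ} (hq : 5 ≤ q) (hm : 2 ≤ m)
    (hi : i + 2 ≤ deltaMax q m) :
    1 + (q + 1) * i < q ^ (m + 1) := by
  have hsq : q ^ 2 ≤ q ^ (m + 1) := Nat.pow_le_pow_right (by omega) (by omega)
  have hq2 : 5 * q ≤ q ^ 2 := by nlinarith
  have hle : (q + 1) * (i + 1) ≤ q ^ (m + 1) - q ^ 2 + q + 3 := by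
    have key := Nat.mul_div_le (q ^ (m + 1) - q ^ 2 + q + 3) (q + 1)
    refine le_trans (Nat.mul_le_mul_left _ ?_) key
    unfold deltaMax at hi
    split_ifs at hi with hc
    · rw [hc.1, show 2 + 1 = 3 from rfl]
      omega
    · omega
  have : (q + 1) * (i + 1) = (q + 1) * i + q + 1 := by ring
  omega

theorem stmt12 (q m : ℕ) (hq : IsPrimePow q) (hq8 : 8 ≤ q) (hqe : Even q)
    (hm : 2 ≤ m) (hme : Even m) (r : ℕ) (hr : r = q + 1)
    (δ : ℕ) (hδ : 2 ≤ δ) (hδmax : δ ≤ deltaMax q m) :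
    ((⋃ i ∈ Finset.range (δ - 1), coset q (q ^ (2 * m) - 1) (1 + r * i)).ncard : ℤ)
      = if δ < istarEven q m + 2 then ((δ : ℤ) - N1 q δ - 1) * m
        else if δ < istarEven q m + 2 + (q ^ m - 1) / (q + 1) then
          ((δ : ℤ) - N1 q δ - 1) * m - (m / 2 : ℕ)
        else ((δ : ℤ) - N1 q δ - N2even q m δ - 1) * m - (m / 2 : ℕ) := by
  subst hr
  obtain ⟨p, hp⟩ := hqe
  obtain ⟨h, hh⟩ := hme
  obtain ⟨n, rfl⟩ : ∃ n, δ = n + 1 := ⟨δ - 1, by omega⟩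
  replace hp : q = 2 * p := by omega
  obtain rfl : m = 2 * h := by omega
  obtain ⟨B, hB⟩ : q + 1 ∣ q ^ (2 * h) - 1 := by
    have h1 : q + 1 ∣ q ^ 2 - 1 := ⟨q - 1, by simpa using Nat.sq_sub_sq q 1⟩
    have h2 := Nat.sub_dvd_pow_sub_pow (q ^ 2) 1 h
    rw [← pow_mul, one_pow] at h2
    exact h1.trans h2
  have hP : 1 < q ^ (2 * h) := Nat.one_lt_pow (by omega) (by omega)
  have hB0 : 0 < B := Nat.pos_of_ne_zero (by rintro rfl; omega)
  have hB' : q ^ (2 * h) = (q + 1) * B + 1 := by omega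
  have hB0' : (0 : ℤ) < B := by exact_mod_cast hB0
  have hmain := ncard_cosetUnion hp (by omega) (by omega) hB0 hB' n fun i hi =>
    progression_lt_of_lt_deltaMax (by omega) (by omega) (by omega)
  rw [cosetUnion] at hmain
  rw [Nat.add_sub_cancel, hmain, istarEven_eq hp hB', hB, Nat.mul_div_cancel_left _ (by omega),
    halfTurnLoss, Nat.mul_div_cancel_left _ (by norm_num)]
  have hdiv := Int.mul_ediv_add_emod ((n : ℤ) - 2) B
  have hmod0 := Int.emod_nonneg ((n : ℤ) - 2) hB0'.ne'
  have hmod1 := Int.emod_lt_of_pos ((n : ℤ) - 2) hB0'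
  have hlt (c : ℕ) : ((n : ℤ) - 2) / B < c ↔ n + 1 < c * B + 1 + 2 := by
    rw [Int.ediv_lt_iff_lt_mul hB0']
    zify
    constructor <;> intro <;> linarith
  have hlt1 := hlt (p + 1)
  have hlt2 := hlt (p + 1 + 1)
  rw [show (p + 1 + 1) * B + 1 + 2 = (p + 1) * B + 1 + 2 + B by ring] at hlt2
  push_cast at hlt1 hlt2
  by_cases c1 : n + 1 < (p + 1) * B + 1 + 2
  · rw [if_pos (hlt1.2 c1), if_pos c1]
    push_cast
    ring
  rw [if_neg (fun hc => c1 (hlt1.1 hc)), if_neg c1]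
  have c1' : ¬ ((n : ℤ) - 2) / B < p + 1 := fun hc => c1 (hlt1.1 hc)
  by_cases c2 : n + 1 < (p + 1) * B + 1 + 2 + B
  · have : ((n : ℤ) - 2) / B = p + 1 := by
      have := hlt2.2 c2
      omega
    rw [if_pos c2, this]
    push_cast
    ring
  · have hN2 : N2even q (2 * h) (n + 1) = ((n : ℤ) - 2) / B - (p + 1) := by
      rw [N2even, istarEven_eq hp hB', hB, Nat.mul_div_cancel_left _ (by omega),
        if_pos ⟨by omega, hδmax⟩]
      have hPz : (q : ℤ) ^ (2 * h) - 1 = (q + 1) * B := by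
        have := congrArg (Nat.cast : ℕ → ℤ) hB'
        push_cast at this
        linarith
      rw [hPz, Int.fdiv_eq_ediv_of_nonneg _ (by positivity),
        Int.mul_ediv_mul_of_pos _ _ (by positivity), show (q + 2) / 2 = p + 1 by omega]
      push_cast
      ring_nf
    rw [if_neg c2, hN2]
    push_cast
    ring
end
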